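/- The double series ∑ 1/(d·d'·lcm(e(d), d')), taken over all pairs (d, d') of squarefree positive integers with d odd, converges (has a finite value). -/

import Mathlib

open scoped Classical

theorem prod_primes_lt_pow_three_le (m : ℕ) (hm : 1 ≤ m) :
    (∏ p ∈ Finset.range (6 * m), if p.Prime then (1 + 1 / (p : ℝ)) else 1) ^ 3 ≤ 14 * m := by
  induction m, hm using Nat.le_induction with
  | base =>
    have h4 : ¬ Nat.Prime 4 := by norm_num
    norm_num [Finset.prod_range_succ, Nat.prime_two, Nat.prime_three, Nat.prime_five, h4]
  | succ m hm ih =>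
    have not_prime {a b : ℕ} (hb : 2 ≤ b) (hba : b < a) (h : b ∣ a) : ¬ a.Prime := fun hp => by
      rcases (Nat.dvd_prime hp).1 h with h | h <;> omega
    have h0 : ¬ (6 * m).Prime := not_prime (b := 2) (by omega) (by omega) (by omega)
    have h2 : ¬ (6 * m + 2).Prime := not_prime (b := 2) (by omega) (by omega) (by omega)
    have h3 : ¬ (6 * m + 3).Prime := not_prime (b := 3) (by omega) (by omega) (by omega)
    have h4 : ¬ (6 * m + 4).Prime := not_prime (b := 2) (by omega) (by omega) (by omega)
    have factor_le (a : ℕ) : (if a.Prime then (1 + 1 / (a : ℝ)) else 1) ≤ 1 + 1 / (a : ℝ) := by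
      split_ifs
      · exact le_rfl
      · simp
    have factor_nonneg (a : ℕ) : (0 : ℝ) ≤ if a.Prime then (1 + 1 / (a : ℝ)) else 1 := by
      split_ifs <;> positivity
    have hm0 : (0 : ℝ) < m := by exact_mod_cast hm
    rw [show 6 * (m + 1) = 6 * m + 1 + 1 + 1 + 1 + 1 + 1 by ring]
    simp only [Finset.prod_range_succ, add_assoc, Nat.reduceAdd]
    rw [if_neg h0, if_neg h2, if_neg h3, if_neg h4]
    simp only [mul_one, mul_pow]
    have h1 := pow_le_pow_left₀ (factor_nonneg (6 * m + 1)) (factor_le (6 * m + 1)) 3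
    have h5 := pow_le_pow_left₀ (factor_nonneg (6 * m + 5)) (factor_le (6 * m + 5)) 3
    calc _ ≤ 14 * (m : ℝ) * (1 + 1 / ((6 * m + 1 : ℕ) : ℝ)) ^ 3
          * (1 + 1 / ((6 * m + 5 : ℕ) : ℝ)) ^ 3 :=
          mul_le_mul (mul_le_mul ih h1 (pow_nonneg (factor_nonneg _) 3) (by positivity)) h5
            (pow_nonneg (factor_nonneg _) 3) (by positivity)
      _ ≤ _ := by
        push_cast
        rw [show (1 : ℝ) + 1 / (6 * m + 1) = (6 * m + 2) / (6 * m + 1) by field_simp; ring,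
          show (1 : ℝ) + 1 / (6 * m + 5) = (6 * m + 6) / (6 * m + 5) by field_simp; ring,
          div_pow, div_pow, mul_assoc, div_mul_div_comm, ← mul_div_assoc, div_le_iff₀ (by positivity),
          ← sub_nonneg]
        ring_nf
        positivity

/-- A product of `1 + 1 / p` over at most `m` primes is `O(m ^ (1 / 3))`. -/
theorem prod_one_add_inv_prime_pow_three_le (P : Finset ℕ) (hP : ∀ p ∈ P, p.Prime) (m : ℕ)
    (hm : 1 ≤ m) (hc : P.card ≤ m) : (∏ p ∈ P, (1 + 1 / (p : ℝ))) ^ 3 ≤ 378 * m := by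
  have hm0 : (0 : ℝ) < m := by exact_mod_cast hm
  have small : ∏ p ∈ P with p < 6 * m, (1 + 1 / (p : ℝ)) ≤
      ∏ p ∈ Finset.range (6 * m), if p.Prime then (1 + 1 / (p : ℝ)) else 1 := by
    rw [← Finset.prod_filter]
    refine Finset.prod_le_prod_of_subset_of_one_le (fun p hp => ?_)
      (fun p _ => by positivity) fun p _ _ => by simp
    simp only [Finset.mem_filter, Finset.mem_range] at hp ⊢
    exact ⟨hp.2, hP p hp.1⟩
  have large : ∏ p ∈ P with ¬ p < 6 * m, (1 + 1 / (p : ℝ)) ≤ 3 := by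
    calc _ ≤ ∏ p ∈ P with ¬ p < 6 * m, Real.exp (1 / m) := by
          refine Finset.prod_le_prod (fun p _ => by positivity) fun p hp => ?_
          have hp' : (m : ℝ) ≤ p := by
            have := (Finset.mem_filter.1 hp).2
            exact_mod_cast (by omega : m ≤ p)
          rw [add_comm]
          exact (Real.add_one_le_exp _).trans (Real.exp_le_exp.2 (by gcongr))
      _ ≤ Real.exp 1 := by
          rw [Finset.prod_const, ← Real.exp_nat_mul, Real.exp_le_exp, mul_one_div,
            div_le_one hm0]
          exact_mod_cast (Finset.card_filter_le _ _).trans hc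
      _ ≤ 3 := Real.exp_one_lt_three.le
  rw [← Finset.prod_filter_mul_prod_filter_not P (· < 6 * m), mul_pow]
  calc _ ≤ (14 * (m : ℝ)) * 3 ^ 3 := by
        refine mul_le_mul ((pow_le_pow_left₀ (by positivity) small 3).trans
          (prod_primes_lt_pow_three_le m hm)) (pow_le_pow_left₀ (by positivity) large 3)
          (by positivity) (by positivity)
    _ = _ := by ring

theorem sum_one_div_squarefree_le_prod (s : Finset ℕ) (D : ℕ) (hD : D ≠ 0)
    (hs : ∀ d ∈ s, Squarefree d ∧ d ∣ D) :
    ∑ d ∈ s, 1 / (d : ℝ) ≤ ∏ p ∈ D.primeFactors, (1 + 1 / (p : ℝ)) := by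
  rw [Finset.prod_one_add]
  have hinj : Set.InjOn Nat.primeFactors (s : Set ℕ) := fun a ha b hb hab => by
    rw [← Nat.prod_primeFactors_of_squarefree (hs a ha).1, hab,
      Nat.prod_primeFactors_of_squarefree (hs b hb).1]
  calc ∑ d ∈ s, 1 / (d : ℝ) = ∑ d ∈ s, ∏ p ∈ d.primeFactors, 1 / (p : ℝ) := by
        refine Finset.sum_congr rfl fun d hd => ?_
        conv_lhs => rw [← Nat.prod_primeFactors_of_squarefree (hs d hd).1]
        simp
    _ = ∑ t ∈ s.image Nat.primeFactors, ∏ p ∈ t, 1 / (p : ℝ) :=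
        by rw [Finset.sum_image hinj]
    _ ≤ _ := by
        refine Finset.sum_le_sum_of_subset_of_nonneg (fun t ht => ?_)
          fun _ _ _ => by positivity
        obtain ⟨d, hd, rfl⟩ := Finset.mem_image.1 ht
        exact Finset.mem_powerset.2 (Nat.primeFactors_mono (hs d hd).2 hD)

theorem two_pow_card_primeFactors_le (n : ℕ) (hn : n ≠ 0) : 2 ^ n.primeFactors.card ≤ n :=
  calc 2 ^ n.primeFactors.card = ∏ _p ∈ n.primeFactors, 2 := by simp
    _ ≤ ∏ p ∈ n.primeFactors, p :=
        Finset.prod_le_prod' fun _ hp => (Nat.prime_of_mem_primeFactors hp).two_le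
    _ ≤ n := Nat.le_of_dvd (Nat.pos_of_ne_zero hn) (Nat.prod_primeFactors_dvd n)

theorem orderOf_two_zmod_pos {d : ℕ} (hd : Odd d) : 0 < orderOf (2 : ZMod d) := by
  have : NeZero d := ⟨hd.pos.ne'⟩
  have hu : IsUnit (2 : ZMod d) := by
    exact_mod_cast (ZMod.isUnit_iff_coprime 2 d).2 hd.coprime_two_left
  obtain ⟨u, hu⟩ := hu
  rw [← hu, orderOf_units]
  exact orderOf_pos u

theorem dvd_two_pow_orderOf_sub_one (d : ℕ) : d ∣ 2 ^ orderOf (2 : ZMod d) - 1 := by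
  rw [← ZMod.natCast_eq_zero_iff, Nat.cast_sub Nat.one_le_two_pow]
  simp [pow_orderOf_eq_one]

/-- The reciprocals of the odd squarefree `d` with `e(d) ≤ M` sum to `O(M ^ (2 / 3))`. -/
theorem sum_one_div_pow_three_le (s : Finset ℕ) (M : ℕ) (hM : 1 ≤ M)
    (hs : ∀ d ∈ s, Odd d ∧ Squarefree d ∧ orderOf (2 : ZMod d) ≤ M) :
    (∑ d ∈ s, 1 / (d : ℝ)) ^ 3 ≤ 378 * (M : ℝ) ^ 2 := by
  set D := ∏ j ∈ Finset.Icc 1 M, (2 ^ j - 1)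
  have hD0 : D ≠ 0 := Finset.prod_ne_zero_iff.2 fun j hj => by
    have := Nat.one_lt_two_pow (n := j) (by have := Finset.mem_Icc.1 hj; omega)
    omega
  have hDle : D ≤ 2 ^ M ^ 2 := by
    calc D ≤ ∏ j ∈ Finset.Icc 1 M, 2 ^ M := Finset.prod_le_prod' fun j hj =>
          (Nat.sub_le _ _).trans (Nat.pow_le_pow_right two_pos (Finset.mem_Icc.1 hj).2)
      _ = 2 ^ M ^ 2 := by simp [← pow_mul, sq]
  have hcard : D.primeFactors.card ≤ M ^ 2 :=
    (Nat.pow_le_pow_iff_right one_lt_two).1 ((two_pow_card_primeFactors_le D hD0).trans hDle)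
  have h := prod_one_add_inv_prime_pow_three_le D.primeFactors
    (fun p => Nat.prime_of_mem_primeFactors) (M ^ 2) (Nat.one_le_pow _ _ hM) hcard
  push_cast at h
  refine (pow_le_pow_left₀ (by positivity)
    (sum_one_div_squarefree_le_prod s D hD0 fun d hd => ⟨(hs d hd).2.1, ?_⟩) 3).trans h
  exact (dvd_two_pow_orderOf_sub_one d).trans (Finset.dvd_prod_of_mem _
    (Finset.mem_Icc.2 ⟨orderOf_two_zmod_pos (hs d hd).1, (hs d hd).2.2⟩))

theorem summable_one_div_mul_orderOf_rpow :
    Summable (fun d : ℕ => if Odd d ∧ Squarefree d then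
      1 / ((d : ℝ) * (orderOf (2 : ZMod d) : ℝ) ^ (3 / 4 : ℝ)) else 0) := by
  set r : ℝ := 2 ^ (-(1 / 12) : ℝ) with hr
  have hr0 : 0 < r := by positivity
  have hr1 : r < 1 := Real.rpow_lt_one_of_one_lt_of_neg (by norm_num) (by norm_num)
  have hgeo : Summable (fun k : ℕ => 12 * r ^ k) :=
    (summable_geometric_of_lt_one hr0.le hr1).mul_left _
  refine summable_of_sum_le (c := ∑' k : ℕ, 12 * r ^ k)
    (fun d => by dsimp only; split_ifs <;> positivity) fun u => ?_
  rw [← Finset.sum_filter]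
  set s := u.filter fun d => Odd d ∧ Squarefree d
  let ℓ : ℕ → ℕ := fun d => Nat.log 2 (orderOf (2 : ZMod d))
  rw [← Finset.sum_fiberwise_of_maps_to (t := s.image ℓ) (g := ℓ)
    fun d hd => Finset.mem_image_of_mem ℓ hd]
  refine (Finset.sum_le_sum fun k _ => ?_).trans
    (hgeo.sum_le_tsum (s.image ℓ) fun k _ => by positivity)
  have hmem {d : ℕ} (hd : d ∈ s.filter fun d => ℓ d = k) :
      Odd d ∧ Squarefree d ∧ 2 ^ k ≤ orderOf (2 : ZMod d) ∧
        orderOf (2 : ZMod d) ≤ 2 ^ (k + 1) := by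
    obtain ⟨hds, rfl⟩ := Finset.mem_filter.1 hd
    obtain ⟨-, hodd, hsq⟩ := Finset.mem_filter.1 hds
    exact ⟨hodd, hsq, Nat.pow_log_le_self 2 (orderOf_two_zmod_pos hodd).ne',
      (Nat.lt_pow_succ_log_self one_lt_two _).le⟩
  have hsum : ∑ d ∈ s with ℓ d = k, 1 / (d : ℝ) ≤ 12 * (2 : ℝ) ^ (2 / 3 * k : ℝ) := by
    refine le_of_pow_le_pow_left₀ three_ne_zero (by positivity) ?_
    refine (sum_one_div_pow_three_le _ (2 ^ (k + 1)) Nat.one_le_two_pow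
      fun d hd => ⟨(hmem hd).1, (hmem hd).2.1, (hmem hd).2.2.2⟩).trans ?_
    have : ((2 : ℝ) ^ (2 / 3 * k : ℝ)) ^ 3 = ((2 : ℝ) ^ k) ^ 2 := by
      rw [← Real.rpow_natCast, ← Real.rpow_mul two_pos.le, ← pow_mul, ← Real.rpow_natCast]
      congr 1
      push_cast
      ring
    rw [mul_pow, this]
    push_cast
    rw [pow_succ (2 : ℝ) k]
    have : (0 : ℝ) < (2 ^ k) ^ 2 := by positivity
    nlinarith
  calc _ ≤ ∑ d ∈ s with ℓ d = k, 1 / (d : ℝ) * (2 : ℝ) ^ (-(3 / 4) * k : ℝ) := by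
        refine Finset.sum_le_sum fun d hd => ?_
        obtain ⟨hodd, -, hle, -⟩ := hmem hd
        have hle' : (2 : ℝ) ^ (k : ℝ) ≤ orderOf (2 : ZMod d) := by
          rw [Real.rpow_natCast]
          exact_mod_cast hle
        have hd0 : (0 : ℝ) < d := by exact_mod_cast hodd.pos
        rw [← one_div_mul_one_div, neg_mul, Real.rpow_neg two_pos.le, mul_comm (3 / 4 : ℝ),
          Real.rpow_mul two_pos.le, ← one_div ((_ : ℝ) ^ _)]
        gcongr
    _ = (∑ d ∈ s with ℓ d = k, 1 / (d : ℝ)) * (2 : ℝ) ^ (-(3 / 4) * k : ℝ) :=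
        (Finset.sum_mul _ _ _).symm
    _ ≤ 12 * (2 : ℝ) ^ (2 / 3 * k : ℝ) * (2 : ℝ) ^ (-(3 / 4) * k : ℝ) := by gcongr
    _ = 12 * r ^ k := by
        rw [hr, mul_assoc, ← Real.rpow_add two_pos, ← Real.rpow_natCast,
          ← Real.rpow_mul two_pos.le]
        congr 2
        ring

/-- The double series `∑ 1/(d·d'·lcm(e(d), d'))` over pairs `(d, d')` of squarefree
positive integers with `d` odd converges, where `e(d)` is the multiplicative order of
`2` modulo `d` (with `e(1) = 1`). -/
theorem double_series_summable :
    Summable (fun dd' : ℕ × ℕ =>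
      if Odd dd'.1 ∧ Squarefree dd'.1 ∧ Squarefree dd'.2 then
        (1 : ℝ) / (dd'.1 * dd'.2 * Nat.lcm (orderOf (2 : ZMod dd'.1)) dd'.2)
      else 0) := by
  have hprod := summable_one_div_mul_orderOf_rpow.mul_of_nonneg
    (Real.summable_one_div_nat_rpow.2 (by norm_num : (1 : ℝ) < 5 / 4))
    (fun d => by dsimp only [Pi.zero_apply]; split_ifs <;> positivity)
    (fun n => by dsimp only [Pi.zero_apply]; positivity)
  refine hprod.of_nonneg_of_le (fun x => by split_ifs <;> positivity) ?_
  rintro ⟨d, n⟩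
  dsimp only
  by_cases h : Odd d ∧ Squarefree d ∧ Squarefree n
  · obtain ⟨hodd, hsq, hn⟩ := h
    rw [if_pos ⟨hodd, hsq, hn⟩, if_pos ⟨hodd, hsq⟩]
    have he := orderOf_two_zmod_pos hodd
    set e := orderOf (2 : ZMod d)
    have hn0 : 0 < n := Nat.pos_of_ne_zero hn.ne_zero
    have hL : 0 < Nat.lcm e n := Nat.lcm_pos he hn0
    have hd0 : (0 : ℝ) < d := by exact_mod_cast hodd.pos
    have he0 : (0 : ℝ) < e := by exact_mod_cast he
    have hn0' : (0 : ℝ) < n := by exact_mod_cast hn0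
    have hL0 : (0 : ℝ) < Nat.lcm e n := by exact_mod_cast hL
    have heL : (e : ℝ) ≤ Nat.lcm e n := by
      exact_mod_cast Nat.le_of_dvd hL (Nat.dvd_lcm_left e n)
    have hnL : (n : ℝ) ≤ Nat.lcm e n := by
      exact_mod_cast Nat.le_of_dvd hL (Nat.dvd_lcm_right e n)
    have key : (e : ℝ) ^ (3 / 4 : ℝ) * (n : ℝ) ^ (1 / 4 : ℝ) ≤ Nat.lcm e n := by
      calc _ ≤ (Nat.lcm e n : ℝ) ^ (3 / 4 : ℝ) * (Nat.lcm e n : ℝ) ^ (1 / 4 : ℝ) := by gcongr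
        _ = _ := by rw [← Real.rpow_add hL0]; norm_num
    have hn54 : (n : ℝ) ^ (5 / 4 : ℝ) = n * (n : ℝ) ^ (1 / 4 : ℝ) := by
      rw [← Real.rpow_one_add' hn0'.le (by norm_num)]
      norm_num
    rw [one_div_mul_one_div, hn54]
    refine one_div_le_one_div_of_le (by positivity) ?_
    calc _ = (d : ℝ) * n * ((e : ℝ) ^ (3 / 4 : ℝ) * (n : ℝ) ^ (1 / 4 : ℝ)) := by ring
      _ ≤ _ := by gcongr
  · rw [if_neg h]
    split_ifs <;> positivity
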